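/- Suppose ρ₁ = ρ₂ = ρ with ρ⁻¹ = t an integer divisible by p, and c = a'·t where a' = v/u ∈ ℚ with integers v, u, gcd(v, u) = 1, and u = p^{ℓ₁}·u' for some ℓ₁ ∈ ℕ and integer u' with p ∤ u'. If p^{ℓ₁+1} divides t, then μ_{M,D} is a spectral measure. -/

import Mathlib

open MeasureTheory Complex Matrix
open scoped ENNReal

noncomputable section

/-- The exponential function `e_λ(x) = e^{-2πi⟨λ,x⟩}` on `ℝ²`. -/
def expChar (lam x : Fin 2 → ℝ) : ℂ :=
  Complex.exp ((-2 * Real.pi * Complex.I) * ((lam 0 * x 0 + lam 1 * x 1 : ℝ) : ℂ))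

/-- The Fourier transform `μ̂(ξ) = ∫ e^{-2πi⟨ξ,x⟩} dμ(x)` of a measure on `ℝ²`. -/
def ftMeasure (μ : Measure (Fin 2 → ℝ)) (ξ : Fin 2 → ℝ) : ℂ :=
  ∫ x, expChar ξ x ∂μ

/-- The mask `m_D(ξ) = (1/p) Σ_{d∈D} e^{-2πi⟨ξ,d⟩}` of a digit system `D : Fin p → ℝ²`. -/
def mask {p : ℕ} (D : Fin p → (Fin 2 → ℝ)) (ξ : Fin 2 → ℝ) : ℂ :=
  (p : ℂ)⁻¹ * ∑ i : Fin p, expChar ξ (D i)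

/-- Integer digits, coerced to real vectors. -/
def digitR {p : ℕ} (D : Fin p → (Fin 2 → ℤ)) : Fin p → (Fin 2 → ℝ) :=
  fun i j => (D i j : ℝ)

/-- `μ` is the self-affine measure of the IFS `φ_d(x) = M⁻¹(x+d)`, `d ∈ D`:
a compactly supported Borel probability measure with `μ = (1/#D) Σ_d μ ∘ φ_d⁻¹`. -/
def IsSelfAffine {p : ℕ} (μ : Measure (Fin 2 → ℝ)) (M : Matrix (Fin 2) (Fin 2) ℝ)
    (D : Fin p → (Fin 2 → ℝ)) : Prop :=
  IsProbabilityMeasure μ ∧ (∃ K : Set (Fin 2 → ℝ), IsCompact K ∧ μ Kᶜ = 0) ∧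
  μ = (p : ℝ≥0∞)⁻¹ • ∑ i : Fin p, μ.map (fun x => M⁻¹.mulVec (x + D i))

/-- `Λ` is an orthogonal set of exponentials for `μ`. -/
def IsOrthoSet (μ : Measure (Fin 2 → ℝ)) (Λ : Set (Fin 2 → ℝ)) : Prop :=
  ∀ l ∈ Λ, ∀ l' ∈ Λ, l ≠ l' → ftMeasure μ (l - l') = 0

/-- `μ` is a spectral measure: some countable set of exponentials forms an
orthonormal (Hilbert) basis of `L²(μ)`. -/
def IsSpectral (μ : Measure (Fin 2 → ℝ)) : Prop :=
  ∃ Λ : Set (Fin 2 → ℝ), Λ.Countable ∧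
    ∃ b : HilbertBasis Λ ℂ (Lp ℂ 2 μ),
      ∀ lam : Λ, ⇑(b lam) =ᵐ[μ] expChar (lam : Fin 2 → ℝ)

/-- The standing assumption on the digit set: `a = (a₁,a₂)` has entries in `[1,p-1]`
and `Z(m_D) = ⋃_{j=1}^{p-1} (j·a/p + ℤ²)`. -/
def ZeroSetCond (p : ℕ) (D : Fin p → (Fin 2 → ℤ)) (a : Fin 2 → ℤ) : Prop :=
  (∀ i, 1 ≤ a i ∧ a i ≤ (p : ℤ) - 1) ∧
  ∀ ξ : Fin 2 → ℝ, mask (digitR D) ξ = 0 ↔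
    ∃ j : ℕ, 1 ≤ j ∧ j ≤ p - 1 ∧ ∃ k : Fin 2 → ℤ,
      ∀ i, ξ i = (j : ℝ) * (a i : ℝ) / p + (k i : ℝ)

/-- The upper-triangular expanding matrix `M = [[ρ₁⁻¹, c],[0, ρ₂⁻¹]]`. -/
def Mupper (ρ₁ ρ₂ c : ℝ) : Matrix (Fin 2) (Fin 2) ℝ := !![ρ₁⁻¹, c; 0, ρ₂⁻¹]

/-- The set `E_a = {h/l : gcd(h,l)=1, l·a₂ − h·a₁ ∈ ℤ∖pℤ} ∪ {0}`. -/
def Ea (p : ℕ) (a : Fin 2 → ℤ) : Set ℝ :=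
  {x | ∃ h l : ℤ, Int.gcd h l = 1 ∧ ¬ ((p : ℤ) ∣ (l * a 1 - h * a 0)) ∧
    x = (h : ℝ) / (l : ℝ)} ∪ {0}


theorem expChar_norm (l x : Fin 2 → ℝ) : ‖expChar l x‖ = 1 := by
  unfold expChar
  rw [Complex.norm_exp]; simp

theorem expChar_add_left (l l' x : Fin 2 → ℝ) : expChar (l + l') x = expChar l x * expChar l' x := by
  unfold expChar
  rw [← Complex.exp_add]; congr 1; simp; ring

theorem expChar_add_right (l x y : Fin 2 → ℝ) : expChar l (x + y) = expChar l x * expChar l y := by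
  unfold expChar
  rw [← Complex.exp_add]; congr 1; simp; ring

theorem expChar_conj (l x : Fin 2 → ℝ) : (starRingEnd ℂ) (expChar l x) = expChar (-l) x := by
  unfold expChar
  rw [← Complex.exp_conj]; congr 1; simp only [map_mul, map_neg, map_ofNat, Complex.conj_ofReal, Complex.conj_I, Pi.neg_apply]
  push_cast; ring

theorem expChar_zero_left (x : Fin 2 → ℝ) : expChar 0 x = 1 := by
  unfold expChar; simp

theorem expChar_continuous (l : Fin 2 → ℝ) : Continuous (expChar l) := by
  unfold expChar; fun_prop

theorem expChar_continuous_left (x : Fin 2 → ℝ) : Continuous (fun l => expChar l x) := by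
  unfold expChar; fun_prop

theorem ft_continuous (μ : Measure (Fin 2 → ℝ)) [IsProbabilityMeasure μ] :
    Continuous (ftMeasure μ) := by
  unfold ftMeasure
  refine continuous_of_dominated (bound := fun _ => 1) ?_ ?_ ?_ ?_
  · intro l; exact (expChar_continuous l).aestronglyMeasurable
  · intro l; exact Filter.Eventually.of_forall fun x => (expChar_norm l x).le
  · exact integrable_const _
  · exact Filter.Eventually.of_forall fun x => expChar_continuous_left x

theorem ft_zero (μ : Measure (Fin 2 → ℝ)) [IsProbabilityMeasure μ] : ftMeasure μ 0 = 1 := by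
  simp [ftMeasure, expChar_zero_left]

theorem mask_norm_le {p : ℕ} (D : Fin p → (Fin 2 → ℝ)) (ξ : Fin 2 → ℝ) : ‖mask D ξ‖ ≤ 1 := by
  unfold mask
  rw [norm_mul, norm_inv, Complex.norm_natCast]
  have h : ‖∑ i : Fin p, expChar ξ (D i)‖ ≤ p := by
    refine (norm_sum_le _ _).trans ?_
    simp [expChar_norm]
  refine (mul_le_mul_of_nonneg_left h (by positivity)).trans ?_
  exact inv_mul_le_one

/-- one-step Hadamard identity -/
theorem hadamard {p : ℕ} (hp : 0 < p) (D : Fin p → (Fin 2 → ℝ)) (c : Fin p → (Fin 2 → ℝ))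
    (h : ∀ j j', j ≠ j' → mask D (c j - c j') = 0) (η : Fin 2 → ℝ) :
    ∑ j, ‖mask D (η + c j)‖ ^ 2 = 1 := by
  have hp0 : (p : ℂ) ≠ 0 := by exact_mod_cast hp.ne'
  let H : Matrix (Fin p) (Fin p) ℂ := Matrix.of fun j d => expChar (c j) (D d)
  let x : Fin p → ℂ := fun d => expChar η (D d)
  have h1 : H * ((p : ℂ)⁻¹ • Hᴴ) = 1 := by
    ext j j'
    have : (H * ((p : ℂ)⁻¹ • Hᴴ)) j j' = mask D (c j - c j') := by
      rw [Matrix.mul_smul, Matrix.smul_apply, Matrix.mul_apply, smul_eq_mul, mask]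
      congr 1
      refine Finset.sum_congr rfl fun d _ => ?_
      simp only [H, Matrix.conjTranspose_apply, Matrix.of_apply]
      rw [sub_eq_add_neg, expChar_add_left, ← expChar_conj]; rfl
    rw [this]
    by_cases hj : j = j'
    · subst hj
      simp [mask, expChar_zero_left, hp0]
    · rw [h j j' hj, Matrix.one_apply_ne hj]
  have h2 : ((p : ℂ)⁻¹ • Hᴴ) * H = 1 := mul_eq_one_comm.mp h1
  have h3 : ∀ j, mask D (η + c j) = (p : ℂ)⁻¹ * (H *ᵥ x) j := by
    intro j
    simp only [mask, Matrix.mulVec, dotProduct, H, x, Matrix.of_apply]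
    congr 1
    refine Finset.sum_congr rfl fun d _ => ?_
    rw [expChar_add_left, mul_comm]
  have h4 : star (H *ᵥ x) ⬝ᵥ (H *ᵥ x) = (p : ℂ) * p := by
    rw [Matrix.star_mulVec, ← Matrix.dotProduct_mulVec, Matrix.mulVec_mulVec]
    have : Hᴴ * H = (p : ℂ) • 1 := by
      rw [← h2, Matrix.smul_mul, smul_smul, mul_inv_cancel₀ hp0, one_smul]
    rw [this, Matrix.smul_mulVec, Matrix.one_mulVec, dotProduct_smul, smul_eq_mul]
    congr 1
    simp only [dotProduct, x, Pi.star_apply, RCLike.star_def]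
    have : ∀ d, (starRingEnd ℂ) (expChar η (D d)) * expChar η (D d) = 1 := by
      intro d
      rw [expChar_conj, ← expChar_add_left]; simp [expChar_zero_left]
    simp [this]
  have h5 : (∑ j, (‖mask D (η + c j)‖ : ℂ) ^ 2) = 1 := by
    have : ∀ j, (‖mask D (η + c j)‖ : ℂ) ^ 2
        = ((p : ℂ)⁻¹ * (p : ℂ)⁻¹) * (star (H *ᵥ x) j * (H *ᵥ x) j) := by
      intro j
      rw [← Complex.conj_mul', h3]
      simp only [map_mul, map_inv₀, Complex.conj_natCast, Pi.star_apply, RCLike.star_def]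
      ring
    rw [Finset.sum_congr rfl fun j _ => this j, ← Finset.mul_sum]
    change _ * (star (H *ᵥ x) ⬝ᵥ (H *ᵥ x)) = 1
    rw [h4]; field_simp
  exact_mod_cast h5

theorem tree {V : Type*} (p : ℕ) (hp : 2 ≤ p) (F : ℕ → ℕ → V → V) (hF : ∀ n v, F n 0 v = v) (v0 : V) :
    ∃ l : ℕ → V, l 0 = v0 ∧ ∀ n r j, r < p ^ n → j < p → l (r + p ^ n * j) = F n j (l r) := by
  have hmod : ∀ N, N ≠ 0 → N % p ^ (Nat.log p N) < N := fun N hN =>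
    (Nat.mod_lt _ (by positivity)).trans_le (Nat.pow_log_le_self p hN)
  let l : ℕ → V := fun N => Nat.strongRecOn N (fun N ih =>
    if hN : N = 0 then v0 else
      F (Nat.log p N) (N / p ^ Nat.log p N) (ih (N % p ^ (Nat.log p N)) (hmod N hN)))
  have hl : ∀ N, l N = if N = 0 then v0 else
      F (Nat.log p N) (N / p ^ Nat.log p N) (l (N % p ^ (Nat.log p N))) := by
    intro N
    simp only [l]
    rw [Nat.strongRecOn_eq]
    split_ifs <;> rfl
  refine ⟨l, by rw [hl]; simp, ?_⟩
  intro n r j hr hj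
  have hpos : 0 < p ^ n := by positivity
  rcases Nat.eq_zero_or_pos j with rfl | hj0
  · simp [hF]
  · have hlog : Nat.log p (r + p ^ n * j) = n := by
      rw [Nat.log_eq_iff (Or.inr ⟨by omega, by positivity⟩)]
      constructor
      · nlinarith
      · rw [pow_succ]; nlinarith
    rw [hl, if_neg (by positivity), hlog]
    congr 2
    · rw [Nat.add_mul_div_left _ _ hpos, Nat.div_eq_of_lt hr, zero_add]
    · rw [Nat.add_mul_mod_self_left, Nat.mod_eq_of_lt hr]

theorem ft_norm_neg (μ : Measure (Fin 2 → ℝ)) (ξ : Fin 2 → ℝ) :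
    ‖ftMeasure μ (-ξ)‖ = ‖ftMeasure μ ξ‖ := by
  unfold ftMeasure
  have : (∫ x, expChar (-ξ) x ∂μ) = (starRingEnd ℂ) (∫ x, expChar ξ x ∂μ) := by
    rw [← integral_conj]
    simp only [expChar_conj]
  rw [this, RCLike.norm_conj]

theorem expChar_memLp (μ : Measure (Fin 2 → ℝ)) [IsProbabilityMeasure μ] (ξ : Fin 2 → ℝ) :
    MemLp (expChar ξ) 2 μ :=
  MemLp.of_bound (expChar_continuous ξ).aestronglyMeasurable 1
    (Filter.Eventually.of_forall fun x => (expChar_norm ξ x).le)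

/-- The exponential as an element of `L²`. -/
def expLp (μ : Measure (Fin 2 → ℝ)) [IsProbabilityMeasure μ] (ξ : Fin 2 → ℝ) : Lp ℂ 2 μ :=
  (expChar_memLp μ ξ).toLp (expChar ξ)

theorem expLp_coe (μ : Measure (Fin 2 → ℝ)) [IsProbabilityMeasure μ] (ξ : Fin 2 → ℝ) :
    ⇑(expLp μ ξ) =ᵐ[μ] expChar ξ := MemLp.coeFn_toLp _

theorem expLp_inner (μ : Measure (Fin 2 → ℝ)) [IsProbabilityMeasure μ] (ξ η : Fin 2 → ℝ) :
    inner ℂ (expLp μ ξ) (expLp μ η) = ftMeasure μ (η - ξ) := by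
  rw [MeasureTheory.L2.inner_def, ftMeasure]
  refine integral_congr_ae ?_
  filter_upwards [expLp_coe μ ξ, expLp_coe μ η] with x h1 h2
  rw [h1, h2, RCLike.inner_apply, expChar_conj, ← expChar_add_left, sub_eq_add_neg]

/-- Trigonometric polynomials restricted to a compact set. -/
def trigAlg (K : Set (Fin 2 → ℝ)) : StarSubalgebra ℂ C(K, ℂ) where
  carrier := (Submodule.span ℂ (Set.range fun ξ : Fin 2 → ℝ =>
    (⟨fun x : K => expChar ξ x, (expChar_continuous ξ).comp continuous_subtype_val⟩ : C(K, ℂ))) :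
      Set C(K, ℂ))
  mul_mem' := by
    intro f g hf hg
    simp only [SetLike.mem_coe] at *
    have := Submodule.mul_mem_mul hf hg
    rw [Submodule.span_mul_span] at this
    refine Submodule.span_mono ?_ this
    rintro _ ⟨_, ⟨ξ, rfl⟩, _, ⟨η, rfl⟩, rfl⟩
    refine ⟨ξ + η, ?_⟩
    ext x
    simp [expChar_add_left]
  one_mem' := by
    refine Submodule.subset_span ⟨0, ?_⟩
    ext x
    simp [expChar_zero_left]
  add_mem' := fun hf hg => Submodule.add_mem _ hf hg
  zero_mem' := Submodule.zero_mem _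
  algebraMap_mem' := by
    intro r
    rw [Algebra.algebraMap_eq_smul_one]
    refine Submodule.smul_mem _ _ (Submodule.subset_span ⟨0, ?_⟩)
    ext x
    simp [expChar_zero_left]
  star_mem' := by
    intro f hf
    simp only [SetLike.mem_coe] at *
    induction hf using Submodule.span_induction with
    | mem f hf =>
      obtain ⟨ξ, rfl⟩ := hf
      refine Submodule.subset_span ⟨-ξ, ?_⟩
      ext x
      simp [← expChar_conj]
    | zero => simp
    | add f g _ _ hf hg => rw [star_add]; exact Submodule.add_mem _ hf hg
    | smul c f _ hf => rw [star_smul]; exact Submodule.smul_mem _ _ hf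

theorem trigAlg_sep (K : Set (Fin 2 → ℝ)) : (trigAlg K).SeparatesPoints := by
  intro x y hxy
  have hne : (x : Fin 2 → ℝ) ≠ y := fun h => hxy (Subtype.ext h)
  set z : Fin 2 → ℝ := (x : Fin 2 → ℝ) - y with hz
  have hz0 : z ≠ 0 := sub_ne_zero.mpr hne
  have hq : 0 < z 0 * z 0 + z 1 * z 1 := by
    by_contra hcon
    apply hz0
    have h0 : z 0 = 0 := by nlinarith [mul_self_nonneg (z 0), mul_self_nonneg (z 1)]
    have h1 : z 1 = 0 := by nlinarith [mul_self_nonneg (z 0), mul_self_nonneg (z 1)]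
    ext i; fin_cases i <;> simp [h0, h1]
  let ξ : Fin 2 → ℝ := (2 * (z 0 * z 0 + z 1 * z 1))⁻¹ • z
  refine ⟨_, ⟨_, Submodule.subset_span ⟨ξ, rfl⟩, rfl⟩, ?_⟩
  simp only [ContinuousMap.coe_mk]
  intro h
  have hx : (x : Fin 2 → ℝ) = z + y := by simp [hz]
  have hone : expChar ξ z = -1 := by
    have : ξ 0 * z 0 + ξ 1 * z 1 = 1 / 2 := by
      simp only [ξ, Pi.smul_apply, smul_eq_mul]
      have hq' : (z 0 ^ 2 + z 1 ^ 2) ≠ 0 := by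
        have : 0 < z 0 ^ 2 + z 1 ^ 2 := by nlinarith
        exact this.ne'
      field_simp
    unfold expChar
    rw [this]
    have : (-2 * (Real.pi : ℂ) * I) * ((1 / 2 : ℝ) : ℂ) = -(Real.pi * I) := by
      push_cast; ring
    rw [this, Complex.exp_neg, Complex.exp_pi_mul_I]; norm_num
  have h' : expChar ξ (x : Fin 2 → ℝ) = expChar ξ (y : Fin 2 → ℝ) := h
  rw [hx, expChar_add_right, hone] at h'
  have hn := expChar_norm ξ (y : Fin 2 → ℝ)
  have : expChar ξ (y : Fin 2 → ℝ) = 0 := by linear_combination (-1/2) * h'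
  rw [this] at hn; simp at hn

theorem density (μ : Measure (Fin 2 → ℝ)) [IsProbabilityMeasure μ] (K : Set (Fin 2 → ℝ))
    (hK : IsCompact K) (hμK : μ Kᶜ = 0) (f : Lp ℂ 2 μ)
    (hf : ∀ ξ, inner ℂ (expLp μ ξ) f = 0) : f = 0 := by
  have hfint : Integrable f μ := (Lp.memLp f).integrable (by norm_num)
  have hK' : ∀ᵐ x ∂μ, x ∈ K := by
    rw [ae_iff]; exact hμK
  have h1 : ∀ ξ, ∫ x, expChar ξ x * f x ∂μ = 0 := by
    intro ξ
    have := hf (-ξ)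
    rw [MeasureTheory.L2.inner_def] at this
    rw [← this]
    refine integral_congr_ae ?_
    filter_upwards [expLp_coe μ (-ξ)] with x h1
    rw [h1, RCLike.inner_apply, expChar_conj, neg_neg, mul_comm]
  have hce : ∀ ξ, Integrable (fun x => expChar ξ x * f x) μ := fun ξ =>
    hfint.bdd_mul (c := 1) (expChar_continuous ξ).aestronglyMeasurable
      (Filter.Eventually.of_forall fun x => (expChar_norm ξ x).le)
  have : CompactSpace K := isCompact_iff_compactSpace.mp hK
  have h2 : ∀ g ∈ trigAlg K, ∃ G : (Fin 2 → ℝ) → ℂ, (∀ x : K, G x = g x) ∧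
      Integrable (fun x => G x * f x) μ ∧ ∫ x, G x * f x ∂μ = 0 := by
    intro g hg
    change g ∈ Submodule.span ℂ _ at hg
    induction hg using Submodule.span_induction with
    | mem g hg =>
      obtain ⟨ξ, rfl⟩ := hg
      exact ⟨expChar ξ, fun x => rfl, hce ξ, h1 ξ⟩
    | zero => exact ⟨0, fun x => rfl, by simp, by simp⟩
    | add g g' _ _ h h' =>
      obtain ⟨G, a1, a2, a3⟩ := h
      obtain ⟨G', b1, b2, b3⟩ := h'
      refine ⟨G + G', fun x => by simp [a1, b1], ?_, ?_⟩
      · simp only [Pi.add_apply, add_mul]; exact a2.add b2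
      · simp only [Pi.add_apply, add_mul]; rw [integral_add a2 b2, a3, b3, add_zero]
    | smul c g _ h =>
      obtain ⟨G, a1, a2, a3⟩ := h
      refine ⟨fun x => c * G x, fun x => by simp [a1], ?_, ?_⟩
      · simp only [mul_assoc]; exact a2.const_mul c
      · simp only [mul_assoc]; rw [integral_const_mul, a3, mul_zero]
  have h3 : ∀ᵐ x ∂μ, f x = 0 := by
    refine ae_eq_zero_of_integral_contDiff_smul_eq_zero hfint.locallyIntegrable ?_
    intro g hg _
    have hgc : Continuous g := hg.continuous
    let gK : C(K, ℂ) := ⟨fun x => (g x : ℂ), by fun_prop⟩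
    have hmem : gK ∈ (trigAlg K).topologicalClosure := by
      rw [ContinuousMap.starSubalgebra_topologicalClosure_eq_top_of_separatesPoints _ (trigAlg_sep K)]
      trivial
    have hmem' : gK ∈ closure (trigAlg K : Set C(K, ℂ)) := hmem
    obtain ⟨C, hC⟩ : ∃ C, ∀ x ∈ K, ‖(g x : ℂ)‖ ≤ C :=
      hK.exists_bound_of_continuousOn (by fun_prop)
    have hgi : Integrable (fun x => (g x : ℂ) * f x) μ :=
      hfint.bdd_mul (c := C) (by fun_prop) (hK'.mono fun x hx => hC x hx)
    rw [← norm_le_zero_iff]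
    refine le_of_forall_pos_le_add fun ε hε => ?_
    have hI : 0 ≤ ∫ x, ‖f x‖ ∂μ := integral_nonneg fun _ => norm_nonneg _
    obtain ⟨h, hh, hd⟩ := Metric.mem_closure_iff.mp hmem' (ε / ((∫ x, ‖f x‖ ∂μ) + 1)) (by positivity)
    obtain ⟨G, G1, G2, G3⟩ := h2 h hh
    have : ∫ x, g x • f x ∂μ = ∫ x, ((g x : ℂ) * f x - G x * f x) ∂μ := by
      rw [integral_sub hgi G2, G3, sub_zero]
      simp
    rw [this, zero_add]
    refine (norm_integral_le_integral_norm _).trans ?_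
    have hb : ∫ x, ‖(g x : ℂ) * f x - G x * f x‖ ∂μ ≤
        ∫ x, (ε / ((∫ x, ‖f x‖ ∂μ) + 1)) * ‖f x‖ ∂μ := by
      refine integral_mono_ae (hgi.sub G2).norm (hfint.norm.const_mul _) ?_
      filter_upwards [hK'] with x hx
      rw [← sub_mul, norm_mul]
      gcongr
      have := ContinuousMap.dist_apply_le_dist (f := gK) (g := h) ⟨x, hx⟩
      rw [← G1, dist_eq_norm] at this
      exact this.trans hd.le
    refine hb.trans ?_
    rw [integral_const_mul, div_mul_eq_mul_div, div_le_iff₀ (by positivity)]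
    nlinarith
  exact (Lp.eq_zero_iff_ae_eq_zero).mpr h3

theorem spectral_criterion (μ : Measure (Fin 2 → ℝ)) [IsProbabilityMeasure μ] (K : Set (Fin 2 → ℝ))
    (hK : IsCompact K) (hμK : μ Kᶜ = 0) (l : ℕ → (Fin 2 → ℝ))
    (ho : ∀ i j, i ≠ j → ftMeasure μ (l i - l j) = 0)
    (hcomp : ∀ ξ, Summable (fun N => ‖ftMeasure μ (ξ + l N)‖ ^ 2) →
      ∑' N, ‖ftMeasure μ (ξ + l N)‖ ^ 2 = 1) : IsSpectral μ := by
  have hinj : Function.Injective l := by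
    intro i j hij
    by_contra hne
    have := ho i j hne
    rw [hij, sub_self, ft_zero] at this
    exact one_ne_zero this
  have hon : Orthonormal ℂ (fun N => expLp μ (l N)) := by
    rw [orthonormal_iff_ite]
    intro i j
    rw [expLp_inner]
    split_ifs with h
    · rw [h, sub_self, ft_zero]
    · exact ho j i (Ne.symm h)
  have hin : ∀ ξ N, ‖inner ℂ (expLp μ (l N)) (expLp μ ξ)‖ = ‖ftMeasure μ (-ξ + l N)‖ := by
    intro ξ N
    rw [expLp_inner, ← ft_norm_neg]
    congr 2; abel
  have hexp_norm : ∀ ξ, ‖expLp μ ξ‖ ^ 2 = 1 := by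
    intro ξ
    rw [norm_sq_eq_re_inner (𝕜 := ℂ), expLp_inner, sub_self, ft_zero]
    simp
  have hspan : (Submodule.span ℂ (Set.range (fun N => expLp μ (l N))))ᗮ = ⊥ := by
    rw [Submodule.eq_bot_iff]
    intro f hf
    have hf' : ∀ N, inner ℂ (expLp μ (l N)) f = 0 := fun N =>
      (Submodule.mem_orthogonal _ _).mp hf _ (Submodule.subset_span ⟨N, rfl⟩)
    refine density μ K hK hμK f fun ξ => ?_
    have hsum := hon.inner_products_summable (expLp μ ξ)
    have ht := hcomp (-ξ) (by simpa only [hin] using hsum)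
    have hs : HasSum (fun N => ‖inner ℂ (expLp μ (l N)) (expLp μ ξ)‖ ^ 2) 1 := by
      simp only [hin] at hsum ⊢
      rw [← ht]; exact hsum.hasSum
    by_contra hne
    have hpos : 0 < ‖inner ℂ (expLp μ ξ) f‖ ^ 2 := by positivity
    have hbd : ∀ s : Finset ℕ, ‖inner ℂ (expLp μ ξ) f‖ ^ 2 ≤
        (1 - ∑ N ∈ s, ‖inner ℂ (expLp μ (l N)) (expLp μ ξ)‖ ^ 2) * ‖f‖ ^ 2 := by
      intro s
      set g := expLp μ ξ - ∑ N ∈ s, inner ℂ (expLp μ (l N)) (expLp μ ξ) • expLp μ (l N) with hg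
      have e1 : inner ℂ (expLp μ ξ) f = inner ℂ g f := by
        rw [hg, inner_sub_left, sum_inner]
        simp [inner_smul_left, hf']
      have e2 : ‖g‖ ^ 2 = 1 - ∑ N ∈ s, ‖inner ℂ (expLp μ (l N)) (expLp μ ξ)‖ ^ 2 := by
        have h0 : inner ℂ g (∑ N ∈ s, inner ℂ (expLp μ (l N)) (expLp μ ξ) • expLp μ (l N)) = 0 := by
          rw [hg, inner_sub_left, hon.inner_sum, inner_sum]
          simp [inner_smul_right, inner_conj_symm, mul_comm]
        have h1 : ‖∑ N ∈ s, inner ℂ (expLp μ (l N)) (expLp μ ξ) • expLp μ (l N)‖ ^ 2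
            = ∑ N ∈ s, ‖inner ℂ (expLp μ (l N)) (expLp μ ξ)‖ ^ 2 := by
          have := inner_self_eq_norm_sq_to_K (𝕜 := ℂ)
            (∑ N ∈ s, inner ℂ (expLp μ (l N)) (expLp μ ξ) • expLp μ (l N))
          rw [hon.inner_sum] at this
          simp only [RCLike.conj_mul] at this
          exact_mod_cast this.symm
        have h2 := norm_add_sq_eq_norm_sq_add_norm_sq_of_inner_eq_zero _ _ h0
        rw [← pow_two, ← pow_two, ← pow_two, h1, hg, sub_add_cancel, hexp_norm] at h2
        rw [hg]; linarith
      rw [e1, ← e2, ← mul_pow]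
      gcongr
      exact norm_inner_le_norm _ _
    have hlim : Filter.Tendsto (fun s : Finset ℕ =>
        (1 - ∑ N ∈ s, ‖inner ℂ (expLp μ (l N)) (expLp μ ξ)‖ ^ 2) * ‖f‖ ^ 2) Filter.atTop
        (nhds ((1 - 1) * ‖f‖ ^ 2)) := (hs.const_sub 1).mul_const _
    have := ge_of_tendsto' hlim hbd
    simp only [sub_self, zero_mul] at this
    linarith
  let e : ℕ ≃ Set.range l := Equiv.ofInjective l hinj
  have hon' : Orthonormal ℂ (fun x : Set.range l => expLp μ (x : Fin 2 → ℝ)) := by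
    have := hon.comp e.symm e.symm.injective
    convert this using 2 with x
    simp only [Function.comp]
    congr 1
    exact (Equiv.apply_ofInjective_symm hinj x).symm
  have hr : Set.range (fun x : Set.range l => expLp μ (x : Fin 2 → ℝ))
      = Set.range (fun N => expLp μ (l N)) := by
    ext y; simp
  refine ⟨Set.range l, Set.countable_range l,
    HilbertBasis.mkOfOrthogonalEqBot hon' (by rw [hr]; exact hspan), fun x => ?_⟩
  rw [HilbertBasis.coe_mkOfOrthogonalEqBot]
  exact expLp_coe μ _

theorem sum_range_pow_succ (p n : ℕ) (hp : 0 < p) (f : ℕ → ℝ) :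
    ∑ N ∈ Finset.range (p ^ (n + 1)), f N
      = ∑ r ∈ Finset.range (p ^ n), ∑ j ∈ Finset.range p, f (r + p ^ n * j) := by
  have hpos : 0 < p ^ n := by positivity
  rw [← Finset.sum_product']
  symm
  refine Finset.sum_bij' (fun x _ => x.1 + p ^ n * x.2) (fun N _ => (N % p ^ n, N / p ^ n)) ?_ ?_ ?_ ?_ ?_
  · rintro ⟨r, j⟩ h
    simp only [Finset.mem_product, Finset.mem_range] at h ⊢
    have : p ^ n * (j + 1) ≤ p ^ n * p := Nat.mul_le_mul_left _ h.2
    rw [pow_succ]; linarith [h.1]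
  · intro N h
    simp only [Finset.mem_product, Finset.mem_range] at h ⊢
    refine ⟨Nat.mod_lt _ hpos, ?_⟩
    rw [Nat.div_lt_iff_lt_mul hpos, mul_comm, ← pow_succ]; exact h
  · rintro ⟨r, j⟩ h
    simp only [Finset.mem_product, Finset.mem_range] at h ⊢
    rw [Nat.add_mul_mod_self_left, Nat.mod_eq_of_lt h.1, Nat.add_mul_div_left _ _ hpos,
      Nat.div_eq_of_lt h.1, zero_add]
  · intro N _
    exact Nat.mod_add_div N (p ^ n)
  · intro x _; rfl

theorem abstract_spectral (μ : Measure (Fin 2 → ℝ)) [IsProbabilityMeasure μ] (K : Set (Fin 2 → ℝ))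
    (hK : IsCompact K) (hμK : μ Kᶜ = 0) (p : ℕ) (hp : 2 ≤ p)
    (m : (Fin 2 → ℝ) → ℂ) (hm1 : ∀ ξ, ‖m ξ‖ ≤ 1)
    (T S : Module.End ℝ (Fin 2 → ℝ)) (hTS : T * S = 1)
    (hFE : ∀ ξ, ftMeasure μ ξ = m (T ξ) * ftMeasure μ (T ξ))
    (Z : Set (Fin 2 → ℝ)) (hper : ∀ ξ, ∀ z ∈ Z, m (ξ + z) = m ξ)
    (c : ℕ → (Fin 2 → ℝ)) (hc0 : c 0 = 0) (w : Fin 2 → ℝ) (hw : w ∈ Z)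
    (hHad : ∀ η, ∑ j ∈ Finset.range p, ‖m (η + c j)‖ ^ 2 = 1)
    (hSc : ∀ i j, (S ^ (i + 1)) (c j) ∈ Z) (hSw : ∀ i j, (S ^ (i + 1)) (c j + w) ∈ Z)
    (hT0 : ∀ ξ, Filter.Tendsto (fun n => (T ^ n) ξ) Filter.atTop (nhds 0))
    (hnv : ∀ ξ, ftMeasure μ ξ ≠ 0 ∨ ftMeasure μ (ξ + w) ≠ 0)
    (B B' : Set (Fin 2 → ℝ)) (hB' : IsCompact B') (hB0 : 0 ∈ B)
    (hBstep : ∀ q ∈ B, ∀ j < p, T q + c j ∈ B') 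
    (hBin : ∀ q ∈ B, ∀ j < p, T q + c j ∈ B ∧ T q + c j + w ∈ B) (hBc : IsCompact B) : IsSpectral μ := by
  have hcont := ft_continuous μ
  -- lower bound
  obtain ⟨ε, hε0, hε1, hε⟩ : ∃ ε : ℝ, 0 < ε ∧ ε ≤ 1 ∧
      ∀ q ∈ B', ε ≤ ‖ftMeasure μ q‖ ∨ ε ≤ ‖ftMeasure μ (q + w)‖ := by
    have hB'ne : B'.Nonempty := ⟨_, hBstep 0 hB0 0 (by omega)⟩
    obtain ⟨q0, hq0, hmin⟩ := hB'.exists_isMinOn hB'ne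
      (f := fun q => max ‖ftMeasure μ q‖ ‖ftMeasure μ (q + w)‖) (by fun_prop)
    refine ⟨min (max ‖ftMeasure μ q0‖ ‖ftMeasure μ (q0 + w)‖) 1, ?_, min_le_right _ _, ?_⟩
    · refine lt_min ?_ one_pos
      rcases hnv q0 with h | h
      · exact lt_max_of_lt_left (norm_pos_iff.mpr h)
      · exact lt_max_of_lt_right (norm_pos_iff.mpr h)
    · intro q hq
      have h1 : max ‖ftMeasure μ q0‖ ‖ftMeasure μ (q0 + w)‖ ≤
        max ‖ftMeasure μ q‖ ‖ftMeasure μ (q + w)‖ := hmin hq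
      have h2 := (min_le_left _ (1 : ℝ)).trans h1
      exact le_max_iff.mp h2
  have hmono : ∀ q, ‖ftMeasure μ q‖ ≤ ‖ftMeasure μ (T q)‖ := by
    intro q
    rw [hFE q, norm_mul]
    exact mul_le_of_le_one_left (norm_nonneg _) (hm1 _)
  -- partial products
  let P : ℕ → (Fin 2 → ℝ) → ℂ := fun n ξ => ∏ k ∈ Finset.range n, m ((T ^ (k + 1)) ξ)
  have hP : ∀ n ξ, ftMeasure μ ξ = P n ξ * ftMeasure μ ((T ^ n) ξ) := by
    intro n
    induction n with
    | zero => intro ξ; simp [P]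
    | succ n ih =>
      intro ξ
      rw [ih ξ, hFE ((T ^ n) ξ)]
      simp only [P, Finset.prod_range_succ, pow_succ' T n, Module.End.mul_apply]
      ring
  have hTS' : ∀ n k x, (T ^ n) ((S ^ (n + k)) x) = (S ^ k) x := by
    intro n
    induction n with
    | zero => intro k x; simp
    | succ n ih =>
      intro k x
      have : n + 1 + k = (n + k) + 1 := by ring
      rw [this, pow_succ, Module.End.mul_apply, pow_succ', Module.End.mul_apply,
        ← Module.End.mul_apply T S, hTS, Module.End.one_apply, ih]
  let b : ℕ → ℕ → (Fin 2 → ℝ) → (Fin 2 → ℝ) := fun n j v =>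
    if j = 0 then 0 else
      if ε ≤ ‖ftMeasure μ ((T ^ (n + 1)) v + c j)‖ then c j else c j + w
  have hb : ∀ n j v, b n j v = c j ∨ b n j v = c j + w := by
    intro n j v
    simp only [b]
    split_ifs with h1 h2
    · left; rw [h1, hc0]
    · left; rfl
    · right; rfl
  have hbS : ∀ n j v i, (S ^ (i + 1)) (b n j v) ∈ Z := by
    intro n j v i
    rcases hb n j v with h | h <;> rw [h]
    · exact hSc i j
    · exact hSw i j
  obtain ⟨l, hl0, hl⟩ := tree p hp (fun n j v => v + (S ^ (n + 1)) (b n j v))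
    (by intro n v; simp [b]) (0 : Fin 2 → ℝ)
  have hPper : ∀ n η j v, P n (η + (S ^ (n + 1)) (b n j v)) = P n η := by
    intro n η j v
    refine Finset.prod_congr rfl fun k hk => ?_
    have hk' : k < n := Finset.mem_range.mp hk
    obtain ⟨i, hi⟩ : ∃ i, n + 1 = (k + 1) + (i + 1) := ⟨n - k - 1, by omega⟩
    rw [map_add]
    refine hper _ _ ?_
    rw [hi, hTS']
    exact hbS n j v i
  have hsum : ∀ n ξ, ∑ N ∈ Finset.range (p ^ n), ‖P n (ξ + l N)‖ ^ 2 = 1 := by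
    intro n
    induction n with
    | zero => intro ξ; simp [P]
    | succ n ih =>
      intro ξ
      rw [sum_range_pow_succ p n (by omega), ← ih ξ]
      refine Finset.sum_congr rfl fun r hr => ?_
      have hr' := Finset.mem_range.mp hr
      have h1 : ∀ j ∈ Finset.range p, ‖P (n + 1) (ξ + l (r + p ^ n * j))‖ ^ 2
          = ‖P n (ξ + l r)‖ ^ 2 * ‖m ((T ^ (n + 1)) (ξ + l r) + c j)‖ ^ 2 := by
        intro j hj
        have hj' := Finset.mem_range.mp hj
        rw [hl n r j hr' hj', ← add_assoc]
        have h2 : P (n + 1) (ξ + l r + (S ^ (n + 1)) (b n j (l r)))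
            = P n (ξ + l r + (S ^ (n + 1)) (b n j (l r))) *
              m ((T ^ (n + 1)) (ξ + l r + (S ^ (n + 1)) (b n j (l r)))) :=
          Finset.prod_range_succ _ _
        have h3 : (T ^ (n + 1)) ((S ^ (n + 1)) (b n j (l r))) = b n j (l r) := by
          have := hTS' (n + 1) 0 (b n j (l r))
          simpa using this
        rw [h2, hPper, map_add _ (ξ + l r), h3, norm_mul, mul_pow]
        congr 3
        rcases hb n j (l r) with h | h <;> rw [h]
        rw [← add_assoc, hper _ _ hw]
      rw [Finset.sum_congr rfl h1, ← Finset.mul_sum, hHad, mul_one]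
  have hinv : ∀ n, ∀ N < p ^ n, (T ^ n) (l N) ∈ B ∧ ε ≤ ‖ftMeasure μ ((T ^ n) (l N))‖ := by
    intro n
    induction n with
    | zero =>
      intro N hN
      have : N = 0 := by simpa using hN
      subst this
      rw [hl0, map_zero, ft_zero]
      exact ⟨hB0, by simpa using hε1⟩
    | succ n ih =>
      intro N hN
      have hpos : 0 < p ^ n := by positivity
      obtain ⟨r, j, hr, hj, rfl⟩ : ∃ r j, r < p ^ n ∧ j < p ∧ N = r + p ^ n * j := by
        refine ⟨N % p ^ n, N / p ^ n, Nat.mod_lt _ hpos, ?_, (Nat.mod_add_div N (p ^ n)).symm⟩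
        rw [Nat.div_lt_iff_lt_mul hpos, mul_comm, ← pow_succ]; exact hN
      obtain ⟨i1, i2⟩ := ih r hr
      have h3 : (T ^ (n + 1)) ((S ^ (n + 1)) (b n j (l r))) = b n j (l r) := by
        have := hTS' (n + 1) 0 (b n j (l r))
        simpa using this
      have h4 : (T ^ (n + 1)) (l r) = T ((T ^ n) (l r)) := by
        rw [pow_succ', Module.End.mul_apply]
      rw [hl n r j hr hj, map_add, h3]
      constructor
      · rw [h4]
        rcases hb n j (l r) with h | h <;> rw [h]
        · exact (hBin _ i1 j hj).1
        · rw [← add_assoc]; exact (hBin _ i1 j hj).2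
      · simp only [b]
        split_ifs with hj0 hcase
        · rw [add_zero, h4]
          exact i2.trans (hmono _)
        · exact hcase
        · rw [← add_assoc]
          have := hε _ (hBstep _ i1 j hj)
          rw [← h4] at this
          exact this.resolve_left hcase
  have hlt : ∀ N : ℕ, N < p ^ N := fun N => Nat.lt_pow_self (by omega)
  refine spectral_criterion μ K hK hμK l ?_ ?_
  · intro i j hij
    let n := i + j
    have hi : i < p ^ n := (hlt i).trans_le (Nat.pow_le_pow_right (by omega) (by omega))
    have hj : j < p ^ n := (hlt j).trans_le (Nat.pow_le_pow_right (by omega) (by omega))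
    have h1 := hsum n (-l j)
    have h2 : ‖P n (-l j + l j)‖ ^ 2 + ‖P n (-l j + l i)‖ ^ 2 ≤ 1 := by
      rw [← h1, ← Finset.sum_pair (f := fun N => ‖P n (-l j + l N)‖ ^ 2) (Ne.symm hij)]
      refine Finset.sum_le_sum_of_subset_of_nonneg ?_ fun _ _ _ => by positivity
      intro x hx
      simp only [Finset.mem_insert, Finset.mem_singleton] at hx
      rcases hx with rfl | rfl <;> simpa
    have h0 : ‖P n 0‖ = 1 := by
      have := hP n 0
      rw [map_zero, ft_zero, mul_one] at this
      rw [← this, norm_one]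
    rw [neg_add_cancel, h0] at h2
    have h3 : P n (-l j + l i) = 0 := by
      rw [← norm_eq_zero]
      nlinarith [norm_nonneg (P n (-l j + l i))]
    rw [hP n, sub_eq_neg_add, h3, zero_mul]
  · intro ξ hsm
    -- eventually lower bound
    have hunif : ∀ᶠ n in Filter.atTop, ∀ q ∈ B,
        ‖ftMeasure μ q‖ - ε / 2 ≤ ‖ftMeasure μ ((T ^ n) ξ + q)‖ := by
      have hU := (hBc.add (isCompact_closedBall (0 : Fin 2 → ℝ) 1)).uniformContinuousOn_of_continuous
        hcont.continuousOn
      rw [Metric.uniformContinuousOn_iff] at hU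
      obtain ⟨δ, hδ, hU⟩ := hU (ε / 2) (by positivity)
      have := (Metric.tendsto_nhds.mp (hT0 ξ)) (min δ 1) (by positivity)
      filter_upwards [this] with n hn q hq
      have hn' : ‖(T ^ n) ξ‖ < min δ 1 := by simpa using hn
      have hd := hU q ⟨q, hq, 0, by simp, by simp⟩ ((T ^ n) ξ + q)
        ⟨q, hq, (T ^ n) ξ, by simpa using (hn'.trans_le (min_le_right _ _)).le, by simp [add_comm]⟩
        (by rw [dist_eq_norm, ← norm_neg]; simpa using hn'.trans_le (min_le_left _ _))
      rw [dist_eq_norm] at hd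
      have := norm_sub_norm_le (ftMeasure μ q) (ftMeasure μ ((T ^ n) ξ + q))
      linarith
    have hlim := tendsto_tsum_of_dominated_convergence (𝓕 := Filter.atTop)
      (f := fun n N => if N < p ^ n then ‖P n (ξ + l N)‖ ^ 2 else 0)
      (g := fun N => ‖ftMeasure μ (ξ + l N)‖ ^ 2)
      (bound := fun N => (4 / ε ^ 2) * ‖ftMeasure μ (ξ + l N)‖ ^ 2) (hsm.mul_left _) ?_ ?_
    · have hone : ∀ n, ∑' N, (if N < p ^ n then ‖P n (ξ + l N)‖ ^ 2 else 0) = 1 := by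
        intro n
        rw [← hsum n ξ, tsum_eq_sum (s := Finset.range (p ^ n))]
        · exact Finset.sum_congr rfl fun N hN => if_pos (Finset.mem_range.mp hN)
        · intro N hN
          exact if_neg (by simpa using hN)
      simp only [hone] at hlim
      exact (tendsto_nhds_unique hlim tendsto_const_nhds)
    · intro N
      have h1 : Filter.Tendsto (fun n => ftMeasure μ ((T ^ n) (ξ + l N))) Filter.atTop (nhds 1) := by
        rw [← ft_zero μ]
        exact (hcont.tendsto 0).comp (hT0 _)
      have h2 : Filter.Tendsto (fun n => ‖ftMeasure μ (ξ + l N)‖ ^ 2 /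
          ‖ftMeasure μ ((T ^ n) (ξ + l N))‖ ^ 2) Filter.atTop
          (nhds (‖ftMeasure μ (ξ + l N)‖ ^ 2 / ‖(1 : ℂ)‖ ^ 2)) :=
        tendsto_const_nhds.div (h1.norm.pow 2) (by simp)
      rw [norm_one, one_pow, div_one] at h2
      refine h2.congr' ?_
      filter_upwards [h1.eventually_ne one_ne_zero, Filter.eventually_ge_atTop N] with n hn hN
      rw [if_pos ((hlt N).trans_le (Nat.pow_le_pow_right (by omega) hN)), hP n (ξ + l N), norm_mul, mul_pow,
        mul_div_cancel_right₀]
      exact pow_ne_zero _ (norm_ne_zero_iff.mpr hn)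
    · filter_upwards [hunif] with n hn N
      split_ifs with hN
      · obtain ⟨i1, i2⟩ := hinv n N hN
        have h1 := hn _ i1
        rw [← map_add] at h1
        have h2 : ε / 2 ≤ ‖ftMeasure μ ((T ^ n) (ξ + l N))‖ := by linarith
        rw [hP n (ξ + l N), norm_mul, mul_pow, Real.norm_of_nonneg (by positivity)]
        have h3 : (ε / 2) ^ 2 ≤ ‖ftMeasure μ ((T ^ n) (ξ + l N))‖ ^ 2 := by gcongr
        have h4 : 1 ≤ 4 / ε ^ 2 * ‖ftMeasure μ ((T ^ n) (ξ + l N))‖ ^ 2 := by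
          rw [div_mul_eq_mul_div, le_div_iff₀ (by positivity)]
          nlinarith
        nlinarith [sq_nonneg ‖P n (ξ + l N)‖]
      · rw [norm_zero]; positivity

/-- Lemma 4.5: with `ρ₁ = ρ₂ = ρ`, `ρ⁻¹ = t ∈ pℤ`, `c = a'·t` where `a' = v/u`,
`gcd(v,u)=1`, `u = p^{ℓ₁}·u'`, `p ∤ u'`: if `p^{ℓ₁+1} ∣ t` then `μ_{M,D}` is a spectral
measure. -/
theorem stmt16 (p : ℕ) (hp : p.Prime) (ρ c : ℝ) (hρ0 : 0 < ρ) (hρ1 : ρ < 1)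
    (D : Fin p → (Fin 2 → ℤ)) (hD : Function.Injective D)
    (a : Fin 2 → ℤ) (hZ : ZeroSetCond p D a)
    (μ : Measure (Fin 2 → ℝ)) (hμ : IsSelfAffine μ (Mupper ρ ρ c) (digitR D))
    (t : ℤ) (ht : ρ⁻¹ = (t : ℝ)) (hpt : (p : ℤ) ∣ t)
    (v u u' : ℤ) (ℓ₁ : ℕ) (hvu : Int.gcd v u = 1)
    (hu : u = (p : ℤ) ^ ℓ₁ * u') (hu' : ¬ (p : ℤ) ∣ u')
    (hc : c = ((v : ℝ) / (u : ℝ)) * (t : ℝ))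
    (hdvd : (p : ℤ) ^ (ℓ₁ + 1) ∣ t) :
    IsSpectral μ := by
  have hp2 : 2 ≤ p := hp.two_le
  have hpR : (p : ℝ) ≠ 0 := by exact_mod_cast hp.ne_zero
  have hpI : Prime (p : ℤ) := Nat.prime_iff_prime_int.mp hp
  have htR : (1 : ℝ) < t := by
    rw [← ht]; exact (one_lt_inv₀ hρ0).mpr hρ1
  have ht2 : 2 ≤ t := by
    have : (1 : ℤ) < t := by exact_mod_cast htR
    omega
  have ht2R : (2 : ℝ) ≤ t := by exact_mod_cast ht2
  have ht0 : (t : ℝ) ≠ 0 := by linarith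
  have hu0 : u' ≠ 0 := by rintro rfl; exact hu' (dvd_zero _)
  have hu0R : (u' : ℝ) ≠ 0 := by exact_mod_cast hu0
  obtain ⟨s, hs⟩ := hdvd
  obtain ⟨hprob, ⟨K, hK, hμK⟩, hself⟩ := hμ
  obtain ⟨ha, hzero⟩ := hZ
  set A : ℝ := (v : ℝ) / (u : ℝ) with hA
  have hAu : A * ((p : ℝ) ^ ℓ₁ * u') = v := by
    have : (u : ℝ) = (p : ℝ) ^ ℓ₁ * u' := by rw [hu]; push_cast; ring
    rw [hA, this]; field_simp
  have hsR : (t : ℝ) = (p : ℝ) ^ (ℓ₁ + 1) * s := by rw [hs]; push_cast; ring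
  let T : Module.End ℝ (Fin 2 → ℝ) := Matrix.toLin' !![(t : ℝ)⁻¹, 0; -A * (t : ℝ)⁻¹, (t : ℝ)⁻¹]
  let S : Module.End ℝ (Fin 2 → ℝ) := Matrix.toLin' !![(t : ℝ), 0; A * t, (t : ℝ)]
  have hT0 : ∀ x, T x 0 = x 0 / t := by
    intro x; simp [T, Matrix.toLin'_apply, Matrix.mulVec, dotProduct, Fin.sum_univ_two]; ring
  have hT1 : ∀ x, T x 1 = (x 1 - A * x 0) / t := by
    intro x; simp [T, Matrix.toLin'_apply, Matrix.mulVec, dotProduct, Fin.sum_univ_two]; ring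
  have hS0 : ∀ x, S x 0 = t * x 0 := by
    intro x; simp [S, Matrix.toLin'_apply, Matrix.mulVec, dotProduct, Fin.sum_univ_two]
  have hS1 : ∀ x, S x 1 = t * (A * x 0 + x 1) := by
    intro x; simp [S, Matrix.toLin'_apply, Matrix.mulVec, dotProduct, Fin.sum_univ_two]; ring
  have hTS : T * S = 1 := by
    refine LinearMap.ext fun x => ?_
    rw [Module.End.mul_apply, Module.End.one_apply]
    ext i; fin_cases i
    · change T (S x) 0 = x 0
      rw [hT0, hS0]; field_simp
    · change T (S x) 1 = x 1
      rw [hT1, hS0, hS1]; field_simp; ring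
  have hTk : ∀ (k : ℕ) x, (T ^ k) x 0 = x 0 / t ^ k ∧ (T ^ k) x 1 = (x 1 - k * A * x 0) / t ^ k := by
    intro k
    induction k with
    | zero => intro x; simp
    | succ k ih =>
      intro x
      obtain ⟨h0, h1⟩ := ih x
      rw [pow_succ', Module.End.mul_apply, hT0, hT1, h0, h1]
      constructor
      · rw [pow_succ]; field_simp
      · field_simp; push_cast; ring
  have hFE : ∀ ξ, ftMeasure μ ξ = mask (digitR D) (T ξ) * ftMeasure μ (T ξ) := by
    intro ξ
    have hM : (Mupper ρ ρ c)⁻¹ = !![(t : ℝ)⁻¹, -A * (t : ℝ)⁻¹; 0, (t : ℝ)⁻¹] := by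
      refine Matrix.inv_eq_right_inv ?_
      rw [Mupper, ht, hc]
      ext i j; fin_cases i <;> fin_cases j <;> simp [Matrix.mul_apply, Fin.sum_univ_two, ht0]
      field_simp; ring
    have hpt : ∀ i x, expChar ξ ((Mupper ρ ρ c)⁻¹.mulVec (x + digitR D i))
        = expChar (T ξ) (digitR D i) * expChar (T ξ) x := by
      intro i x
      rw [← expChar_add_right, hM]
      unfold expChar
      congr 3
      rw [hT0, hT1]
      simp [Matrix.mulVec, dotProduct, Fin.sum_univ_two]
      field_simp; ring
    have hmeas : ∀ i, Measurable (fun x => (Mupper ρ ρ c)⁻¹.mulVec (x + digitR D i)) := by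
      intro i
      have : Continuous (fun x => (Mupper ρ ρ c)⁻¹.mulVec (x + digitR D i)) := by fun_prop
      exact this.measurable
    have hi : ∀ (ν : Measure (Fin 2 → ℝ)) [IsFiniteMeasure ν], Integrable (expChar ξ) ν := by
      intro ν _
      exact Integrable.of_bound (expChar_continuous ξ).aestronglyMeasurable 1
        (Filter.Eventually.of_forall fun x => (expChar_norm ξ x).le)
    unfold ftMeasure mask
    conv_lhs => rw [hself]
    rw [integral_smul_measure, integral_finsetSum_measure]
    · rw [mul_assoc, Finset.sum_mul]
      have : ∀ i, ∫ x, expChar ξ x ∂(μ.map (fun x => (Mupper ρ ρ c)⁻¹.mulVec (x + digitR D i)))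
          = expChar (T ξ) (digitR D i) * ∫ x, expChar (T ξ) x ∂μ := by
        intro i
        rw [integral_map (hmeas i).aemeasurable (expChar_continuous ξ).aestronglyMeasurable]
        simp only [hpt]
        rw [integral_const_mul]
      simp only [this]
      rw [ENNReal.toReal_inv, ENNReal.toReal_natCast, Complex.real_smul]
      push_cast; rfl
    · intro i _
      exact hi _
  let Z : Set (Fin 2 → ℝ) := {z | ∃ k : Fin 2 → ℤ, ∀ i, z i = k i}
  have hper : ∀ ξ, ∀ z ∈ Z, mask (digitR D) (ξ + z) = mask (digitR D) ξ := by
    rintro ξ z ⟨k, hk⟩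
    unfold mask
    congr 1
    refine Finset.sum_congr rfl fun i _ => ?_
    rw [expChar_add_left]
    have : expChar z (digitR D i) = 1 := by
      unfold expChar
      rw [hk, hk]
      rw [Complex.exp_eq_one_iff]
      refine ⟨-(k 0 * D i 0 + k 1 * D i 1), ?_⟩
      simp only [digitR]
      push_cast; ring
    rw [this, mul_one]
  let cc : ℕ → (Fin 2 → ℝ) := fun j i => u' * j * a i / p
  let w : Fin 2 → ℝ := ![0, 1]
  have hw : w ∈ Z := ⟨![0, 1], fun i => by fin_cases i <;> simp [w]⟩
  let L : Set (Fin 2 → ℝ) := {z | ∃ k0 k1 : ℤ, z 0 = u' * k0 ∧ z 1 = k1}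
  have hLZ : L ⊆ Z := by
    rintro z ⟨k0, k1, h0, h1⟩
    refine ⟨![u' * k0, k1], fun i => ?_⟩
    fin_cases i <;> simp [h0, h1]
  have hSL : ∀ z ∈ L, S z ∈ L := by
    rintro z ⟨k0, k1, h0, h1⟩
    refine ⟨t * k0, p * s * v * k0 + t * k1, ?_, ?_⟩
    · rw [hS0, h0]; push_cast; ring
    · rw [hS1, h0, h1]; push_cast
      rw [← hAu, hsR, pow_succ]; ring
  have hcL : ∀ j, S (cc j) ∈ L := by
    intro j
    refine ⟨p ^ ℓ₁ * s * j * a 0, s * v * j * a 0 + p ^ ℓ₁ * s * u' * j * a 1, ?_, ?_⟩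
    · rw [hS0, hsR]; simp only [cc]; push_cast; field_simp; ring
    · rw [hS1, hsR]; simp only [cc]; push_cast
      rw [← hAu]; field_simp; ring
  have hwL : S w ∈ L := by
    refine hSL _ ⟨0, 1, ?_, ?_⟩ <;> simp [w]
  have hLadd : ∀ x ∈ L, ∀ y ∈ L, x + y ∈ L := by
    rintro x ⟨k0, k1, h0, h1⟩ y ⟨m0, m1, g0, g1⟩
    refine ⟨k0 + m0, k1 + m1, ?_, ?_⟩
    · rw [Pi.add_apply, h0, g0]; push_cast; ring
    · rw [Pi.add_apply, h1, g1]; push_cast; ring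
  have hSpow : ∀ (i : ℕ) z, S z ∈ L → (S ^ (i + 1)) z ∈ L := by
    intro i
    induction i with
    | zero => intro z hz; simpa using hz
    | succ i ih =>
      intro z hz
      rw [pow_succ', Module.End.mul_apply]
      exact hSL _ (ih z hz)
  have hHad : ∀ η, ∑ j ∈ Finset.range p, ‖mask (digitR D) (η + cc j)‖ ^ 2 = 1 := by
    intro η
    rw [Finset.sum_range]
    refine hadamard hp.pos (digitR D) (fun j : Fin p => cc j) ?_ η
    intro j j' hjj
    rw [hzero]
    have hnd : ¬ (p : ℤ) ∣ u' * ((j : ℤ) - (j' : ℤ)) := by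
      intro hd
      rcases hpI.dvd_or_dvd hd with h | h
      · exact hu' h
      · apply hjj
        have h1 := j.isLt
        have h2 := j'.isLt
        have : ((j : ℤ) - (j' : ℤ)) = 0 := by
          apply Int.eq_zero_of_abs_lt_dvd h
          rw [abs_lt]; constructor <;> omega
        apply Fin.ext; omega
    set X : ℤ := u' * ((j : ℤ) - (j' : ℤ)) with hX
    have hpp : (0 : ℤ) < p := by exact_mod_cast hp.pos
    have hm0 : 0 ≤ X % p := Int.emod_nonneg _ hpp.ne'
    have hm1 : X % p < p := Int.emod_lt_of_pos _ hpp
    have hm2 : X % p ≠ 0 := fun h => hnd (Int.dvd_of_emod_eq_zero h)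
    obtain ⟨J, hJ⟩ := Int.eq_ofNat_of_zero_le hm0
    refine ⟨J, by omega, by omega, fun i => X / p * a i, fun i => ?_⟩
    have hXe : (X : ℝ) = p * ((X / p : ℤ) : ℝ) + (J : ℝ) := by
      have := Int.mul_ediv_add_emod X p
      rw [hJ] at this
      exact_mod_cast this.symm
    have hXr : (X : ℝ) = u' * ((j : ℕ) - (j' : ℕ) : ℝ) := by rw [hX]; push_cast; ring
    simp only [Pi.sub_apply, cc]
    push_cast
    have : (u' : ℝ) * (j : ℕ) * a i / p - u' * (j' : ℕ) * a i / p = (X : ℝ) * a i / p := by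
      rw [hXr]; ring
    rw [this, hXe]; field_simp; ring
  have hT0' : ∀ ξ, Filter.Tendsto (fun n => (T ^ n) ξ) Filter.atTop (nhds 0) := by
    intro ξ
    have g0 : Filter.Tendsto (fun n : ℕ => (1 : ℝ) / (t : ℝ) ^ n) Filter.atTop (nhds 0) := by
      have := tendsto_pow_const_div_const_pow_of_one_lt 0 htR
      simpa using this
    have g1 : Filter.Tendsto (fun n : ℕ => (n : ℝ) / (t : ℝ) ^ n) Filter.atTop (nhds 0) := by
      have := tendsto_pow_const_div_const_pow_of_one_lt 1 htR
      simpa using this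
    rw [tendsto_pi_nhds]
    intro i
    fin_cases i
    · change Filter.Tendsto (fun n => (T ^ n) ξ 0) Filter.atTop (nhds 0)
      have := g0.const_mul (ξ 0)
      rw [mul_zero] at this
      refine this.congr fun n => ?_
      rw [(hTk n ξ).1]; ring
    · change Filter.Tendsto (fun n => (T ^ n) ξ 1) Filter.atTop (nhds 0)
      have := (g0.const_mul (ξ 1)).sub (g1.const_mul (A * ξ 0))
      rw [mul_zero, mul_zero, sub_zero] at this
      refine this.congr fun n => ?_
      rw [(hTk n ξ).2]; ring
  have hfac : ∀ ξ, ftMeasure μ ξ = 0 → ∃ k : ℕ, mask (digitR D) ((T ^ (k + 1)) ξ) = 0 := by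
    intro ξ h0
    by_contra! hne
    have hall : ∀ n, ftMeasure μ ((T ^ n) ξ) = 0 := by
      intro n
      induction n with
      | zero => simpa using h0
      | succ n ih =>
        rw [hFE] at ih
        have h1 : T ((T ^ n) ξ) = (T ^ (n + 1)) ξ := by
          rw [pow_succ', Module.End.mul_apply]
        rw [h1] at ih
        exact (mul_eq_zero.mp ih).resolve_left (hne _)
    have hl := ((ft_continuous μ).tendsto 0).comp (hT0' ξ)
    have hl' : Filter.Tendsto (fun n => ftMeasure μ ((T ^ n) ξ)) Filter.atTop
      (nhds (ftMeasure μ 0)) := hl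
    simp only [hall, ft_zero] at hl'
    exact zero_ne_one (tendsto_nhds_unique tendsto_const_nhds hl')
  have hnv : ∀ ξ, ftMeasure μ ξ ≠ 0 ∨ ftMeasure μ (ξ + w) ≠ 0 := by
    intro ξ
    by_contra! hcon
    obtain ⟨k, hk⟩ := hfac _ hcon.1
    obtain ⟨k', hk'⟩ := hfac _ hcon.2
    rw [hzero] at hk hk'
    obtain ⟨j, hj1, hj2, z, hz⟩ := hk
    obtain ⟨j', hj1', hj2', z', hz'⟩ := hk'
    have hnd : ∀ (j : ℕ) (z : Fin 2 → ℤ), 1 ≤ j → j ≤ p - 1 → ¬ (p : ℤ) ∣ j * a 0 + p * z 0 := by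
      intro j z h1 h2 hd
      have h3 : (p : ℤ) ∣ j * a 0 := (dvd_add_left (dvd_mul_right _ _)).mp hd
      rcases hpI.dvd_or_dvd h3 with h | h
      · have := Nat.le_of_dvd (by omega) (Int.natCast_dvd_natCast.mp h); omega
      · have h4 := ha 0
        have := Int.le_of_dvd (by omega) h
        omega
    have hpow : ∀ (k k' : ℕ) (n n' : ℤ), ¬ (p : ℤ) ∣ n → t ^ k * n = t ^ k' * n' → k' ≤ k := by
      intro k k' n n' hn he
      by_contra! hlt
      obtain ⟨i, rfl⟩ : ∃ i, k' = k + (i + 1) := ⟨k' - k - 1, by omega⟩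
      rw [pow_add, mul_assoc] at he
      have h1 := mul_left_cancel₀ (pow_ne_zero k (by omega : t ≠ 0)) he
      apply hn
      rw [h1]
      exact Dvd.dvd.mul_right (dvd_pow hpt (by omega)) _
    have hw0 : (ξ + w) 0 = ξ 0 := by simp [w]
    have hw1 : (ξ + w) 1 = ξ 1 + 1 := by simp [w]
    have e0 := hz 0
    have e0' := hz' 0
    rw [(hTk _ _).1] at e0 e0'
    rw [hw0] at e0'
    have htk : ∀ k : ℕ, (t : ℝ) ^ k ≠ 0 := fun k => pow_ne_zero k ht0
    have q0 : (p : ℝ) * ξ 0 = t ^ (k + 1) * (j * a 0 + p * z 0) := by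
      rw [div_eq_iff (htk _)] at e0
      rw [e0]; field_simp
    have q0' : (p : ℝ) * ξ 0 = t ^ (k' + 1) * (j' * a 0 + p * z' 0) := by
      rw [div_eq_iff (htk _)] at e0'
      rw [e0']; field_simp
    have hfint : t ^ (k + 1) * ((j : ℤ) * a 0 + p * z 0) = t ^ (k' + 1) * ((j' : ℤ) * a 0 + p * z' 0) := by
      have := q0.symm.trans q0'
      exact_mod_cast this
    have hkk : k = k' := by
      have h1 := hpow _ _ _ _ (hnd j z hj1 hj2) hfint
      have h2 := hpow _ _ _ _ (hnd j' z' hj1' hj2') hfint.symm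
      omega
    subst hkk
    have hn := mul_left_cancel₀ (pow_ne_zero (k + 1) (by omega : t ≠ 0)) hfint
    have hjj : j = j' := by
      have h1 : (p : ℤ) ∣ ((j : ℤ) - j') * a 0 := ⟨z' 0 - z 0, by linear_combination hn⟩
      rcases hpI.dvd_or_dvd h1 with h | h
      · have : ((j : ℤ) - j') = 0 := by
          apply Int.eq_zero_of_abs_lt_dvd h
          rw [abs_lt]; constructor <;> omega
        omega
      · have h4 := ha 0
        have := Int.le_of_dvd (by omega) h
        omega
    subst hjj
    have e1 := hz 1
    have e1' := hz' 1
    rw [(hTk _ _).2] at e1 e1'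
    rw [hw0, hw1] at e1'
    rw [div_eq_iff (htk _)] at e1 e1'
    have hone : (1 : ℝ) = (z' 1 - z 1) * t ^ (k + 1) := by linear_combination e1' - e1
    have hone' : (1 : ℤ) = (z' 1 - z 1) * t ^ (k + 1) := by exact_mod_cast hone
    have hd : (p : ℤ) ∣ 1 := by
      rw [hone']
      exact Dvd.dvd.mul_left (dvd_pow hpt (by omega)) _
    exact hpI.not_isUnit (isUnit_of_dvd_one hd)
  have hbdd : ∀ i, ∃ C, ∀ j < p, |cc j i| ≤ C := by
    intro i
    refine ⟨∑ j ∈ Finset.range p, |cc j i|, fun j hj => ?_⟩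
    exact Finset.single_le_sum (f := fun j => |cc j i|) (fun _ _ => abs_nonneg _) (Finset.mem_range.mpr hj)
  obtain ⟨C0, hC0⟩ := hbdd 0
  obtain ⟨C1, hC1⟩ := hbdd 1
  have hC0' : 0 ≤ C0 := (abs_nonneg _).trans (hC0 0 hp.pos)
  have hC1' : 0 ≤ C1 := (abs_nonneg _).trans (hC1 0 hp.pos)
  let X : ℝ := 2 * C0
  let Y : ℝ := |A| * X + 2 * C1 + 2
  have hX0 : 0 ≤ X := by positivity
  have hY0 : 0 ≤ Y := by positivity
  let B : Set (Fin 2 → ℝ) := Set.Icc ![-X, -Y] ![X, Y]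
  have hBmem : ∀ q, q ∈ B ↔ |q 0| ≤ X ∧ |q 1| ≤ Y := by
    intro q
    simp only [B, Set.mem_Icc, Pi.le_def, Fin.forall_fin_two, abs_le]
    simp; tauto
  have hBin : ∀ q ∈ B, ∀ j < p, T q + cc j ∈ B ∧ T q + cc j + w ∈ B := by
    intro q hq j hj
    rw [hBmem] at hq
    have e0 : |T q 0| ≤ X / 2 := by
      rw [hT0, abs_div, abs_of_pos (by linarith : (0 : ℝ) < t)]
      gcongr; exact hq.1
    have e1 : |T q 1| ≤ (Y + |A| * X) / 2 := by
      rw [hT1, abs_div, abs_of_pos (by linarith : (0 : ℝ) < t)]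
      gcongr
      refine (abs_sub _ _).trans ?_
      rw [abs_mul]
      gcongr
      · exact hq.2
      · exact hq.1
    have f0 := hC0 j hj
    have f1 := hC1 j hj
    have g0 := abs_add_le (T q 0) (cc j 0)
    have g1 := abs_add_le (T q 1) (cc j 1)
    have g2 := abs_add_le (T q 1 + cc j 1) 1
    rw [abs_one] at g2
    have hX : X = 2 * C0 := rfl
    have hY : Y = |A| * X + 2 * C1 + 2 := rfl
    rw [hBmem, hBmem]
    simp only [Pi.add_apply, w]
    simp only [Matrix.cons_val_zero, Matrix.cons_val_one, add_zero]
    refine ⟨⟨?_, ?_⟩, ?_, ?_⟩ <;> linarith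
  have hBc : IsCompact B := isCompact_Icc
  refine abstract_spectral μ K hK hμK p hp2 (mask (digitR D)) (mask_norm_le _) T S hTS hFE Z hper
    cc ?_ w hw hHad (fun i j => hLZ (hSpow i _ (hcL j))) (fun i j => hLZ (hSpow i _ ?_)) hT0' hnv
    B B hBc ?_ (fun q hq j hj => (hBin q hq j hj).1) hBin hBc
  · ext i; simp [cc]
  · rw [map_add]; exact hLadd _ (hcL j) _ hwL
  · rw [hBmem]; simp [hX0, hY0]

end
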